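/- Let α ∈ (0,1), let θ ∈ (0,1) be fixed, and let g : (0,∞) → ℝ be such that g and y ↦ y·g(y) belong to L¹(0,∞) and g has compact support. Then there exists a constant C > 0 (depending on α and θ but not on g or t) such that for all t > 1, ‖w_1(·,t)‖_{L^{1/(1−θ)}(0,∞)} ≤ C·t^{−(1+θ)/(1+α)}·‖y g(y)‖_{L¹(0,∞)}. -/

import Mathlib

open Real MeasureTheory Set Filter Topology

noncomputable def bCoef (α : ℝ) (n : ℕ) : ℝ :=
  ∏ i ∈ Finset.range n, Real.Gamma (α * i + i + 2) / Real.Gamma (α * (i + 1) + i + 2)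

/-- The profile function `Φ(x) = ∑ bₙ (−x^{1+α}/(1+α))ⁿ`. -/
noncomputable def Phi (α : ℝ) (x : ℝ) : ℝ :=
  ∑' n : ℕ, bCoef α n * (-(x ^ (1 + α)) / (1 + α)) ^ n

/-- The Caputo fractional derivative of order `α`. -/
noncomputable def caputo (α : ℝ) (f : ℝ → ℝ) (x : ℝ) : ℝ :=
  (1 / Real.Gamma (1 - α)) * ∫ τ in (0:ℝ)..x, deriv f τ * (x - τ) ^ (-α)

/-- The normalizing constant `a₀` with `1/a₀ = 2∫₀^∞ Φ`. -/
noncomputable def a0 (α : ℝ) : ℝ := (2 * ∫ x in Set.Ioi (0:ℝ), Phi α x)⁻¹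

/-- The fundamental solution `𝔈_t(x) = a₀ t^{−1/(1+α)} Φ(|x| t^{−1/(1+α)})`. -/
noncomputable def fundSol (α t x : ℝ) : ℝ :=
  a0 α * t ^ (-1/(1+α)) * Phi α (|x| * t ^ (-1/(1+α)))

noncomputable def C1 (α : ℝ) : ℝ :=
  α * (2:ℝ) ^ (1+α) * max (∫ u in (1/2:ℝ)..1, u ^ (-(1+α)) * (1-u) ^ (α-1)) 2

noncomputable def C2 (α : ℝ) : ℝ := 2 * a0 α * C1 α


lemma hs_congr {f g : ℕ → ℝ} {a : ℝ} (h : ∀ n, f n = g n) : HasSum f a ↔ HasSum g a := by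
  rw [funext h]

/-- coefficients of an entire power series -/
def EntCoef (c : ℕ → ℝ) : Prop := ∀ r : ℝ, 0 ≤ r → Summable (fun n => |c n| * r ^ n)

noncomputable def PSer (c : ℕ → ℝ) (z : ℝ) : ℝ := ∑' n, c n * z ^ n

lemma EntCoef.summable {c : ℕ → ℝ} (hc : EntCoef c) (z : ℝ) : Summable (fun n => c n * z ^ n) := by
  refine Summable.of_norm ?_
  simpa [abs_mul, abs_pow] using hc |z| (abs_nonneg z)

lemma EntCoef.shift {c : ℕ → ℝ} (hc : EntCoef c) :
    EntCoef (fun n => ((n : ℝ) + 1) * c (n + 1)) := by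
  intro r hr
  have h := (summable_nat_add_iff 1).2 (hc (2 * max r 1) (by positivity))
  refine Summable.of_nonneg_of_le (fun n => by positivity) (fun n => ?_) h
  have h1 : (n : ℝ) + 1 ≤ 2 ^ (n + 1) := by
    exact_mod_cast (Nat.lt_two_pow_self (n := n + 1)).le
  have h2 : r ^ n ≤ (max r 1) ^ (n + 1) :=
    (pow_le_pow_left₀ hr (le_max_left r 1) n).trans
      (pow_le_pow_right₀ (le_max_right r 1) (Nat.le_succ n))
  rw [abs_mul, abs_of_nonneg (by positivity : (0:ℝ) ≤ (n : ℝ) + 1), mul_pow]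
  calc ((n : ℝ) + 1) * |c (n + 1)| * r ^ n = |c (n + 1)| * (((n : ℝ) + 1) * r ^ n) := by ring
    _ ≤ _ := by gcongr

lemma PSer.hasDerivAt {c : ℕ → ℝ} (hc : EntCoef c) (z : ℝ) :
    HasDerivAt (PSer c) (PSer (fun n => ((n : ℝ) + 1) * c (n + 1)) z) z := by
  set R : ℝ := |z| + 1 with hR
  have hR0 : 0 < R := by positivity
  have key := hasDerivAt_tsum_of_isPreconnected (𝕜 := ℝ)
    (g := fun n z => c n * z ^ n) (g' := fun n z => c n * ((n : ℝ) * z ^ (n - 1)))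
    (u := fun n => |c n| * ((n : ℝ) * R ^ (n - 1))) (t := Metric.ball (0:ℝ) R) (y₀ := 0) (y := z)
    ?_ Metric.isOpen_ball (convex_ball (0:ℝ) R).isPreconnected ?_ ?_ ?_ ?_ ?_
  · have e : ∑' n, c n * ((n : ℝ) * z ^ (n - 1))
        = PSer (fun n => ((n : ℝ) + 1) * c (n + 1)) z := by
      have hs : Summable (fun n => c n * ((n : ℝ) * z ^ (n - 1))) := by
        rw [← summable_nat_add_iff 1]
        refine (hc.shift.summable z).congr (fun n => ?_)
        simp; ring
      rw [hs.tsum_eq_zero_add]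
      simp only [PSer]
      simp
      refine tsum_congr (fun n => ?_)
      ring
    rw [← e]; exact key
  · rw [← summable_nat_add_iff 1]
    refine (hc.shift R hR0.le).congr (fun n => ?_)
    rw [abs_mul, abs_of_nonneg (by positivity : (0:ℝ) ≤ (n : ℝ) + 1)]
    simp; ring
  · intro n y _
    exact (hasDerivAt_pow n y).const_mul (c n)
  · intro n y hy
    have : |y| ≤ R := by simpa using (Metric.mem_ball.1 hy).le
    rw [norm_mul, norm_mul, norm_pow]
    simp only [Real.norm_eq_abs, Nat.abs_cast]
    gcongr
  · simpa using hR0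
  · exact hc.summable 0
  · simp [hR]

lemma PSer.continuous {c : ℕ → ℝ} (hc : EntCoef c) : Continuous (PSer c) :=
  continuous_iff_continuousAt.2 fun z => (PSer.hasDerivAt hc z).continuousAt

lemma beta_scaled {a b x : ℝ} (ha : 0 < a) (hb : 0 < b) (hx : 0 < x) :
    ∫ τ in (0:ℝ)..x, (x - τ) ^ (a - 1) * τ ^ (b - 1)
      = x ^ (a + b - 1) * (Real.Gamma a * Real.Gamma b / Real.Gamma (a + b)) := by
  have h := Complex.betaIntegral_scaled (b : ℂ) (a : ℂ) hx
  have e : ∫ τ in (0:ℝ)..x, (τ : ℂ) ^ ((b : ℂ) - 1) * ((x : ℂ) - τ) ^ ((a : ℂ) - 1)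
      = ∫ τ in (0:ℝ)..x, (((x - τ) ^ (a - 1) * τ ^ (b - 1) : ℝ) : ℂ) := by
    refine intervalIntegral.integral_congr_ae (ae_of_all _ fun τ hτ => ?_)
    rw [uIoc_of_le hx.le] at hτ
    push_cast
    rw [Complex.ofReal_cpow (sub_nonneg.2 hτ.2), Complex.ofReal_cpow hτ.1.le]
    push_cast; ring_nf
  rw [e, intervalIntegral.integral_ofReal, Complex.betaIntegral_eq_Gamma_mul_div _ _ (by simpa) (by simpa)] at h
  simp only [Complex.Gamma_ofReal, ← Complex.ofReal_add] at h
  have h2 : ((x : ℂ) ^ (((b + a : ℝ) : ℂ) - 1)) = ((x ^ (b + a - 1) : ℝ) : ℂ) := by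
    rw [Complex.ofReal_cpow hx.le]; push_cast; rfl
  rw [h2] at h
  have h3 := Complex.ofReal_injective (h.trans (by push_cast; rfl :
    _ = ((x ^ (b + a - 1) * (Real.Gamma b * Real.Gamma a / Real.Gamma (b + a)) : ℝ) : ℂ)))
  rw [h3, add_comm b a, mul_comm (Real.Gamma b)]

lemma kernel_intervalIntegrable {a x : ℝ} (ha : 0 < a) :
    IntervalIntegrable (fun τ => (x - τ) ^ (a - 1)) volume 0 x := by
  have h := (intervalIntegral.intervalIntegrable_rpow' (a := 0) (b := x) (r := a - 1) (by linarith))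
  simpa using (h.comp_sub_left x).symm

lemma hasSum_frac {c : ℕ → ℝ} (hc : EntCoef c) {a β δ x : ℝ} (ha : 0 < a) (hβ : 0 < β)
    (hδ : 0 ≤ δ) (hx : 0 < x) :
    HasSum (fun n : ℕ => c n * (x ^ (a + (β * n + δ)) *
        (Real.Gamma a * Real.Gamma (β * n + δ + 1) / Real.Gamma (a + (β * n + δ + 1)))))
      (∫ τ in (0:ℝ)..x, (x - τ) ^ (a - 1) * (τ ^ δ * PSer c (τ ^ β))) := by
  have e : ∀ n : ℕ, c n * (x ^ (a + (β * n + δ)) *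
        (Real.Gamma a * Real.Gamma (β * n + δ + 1) / Real.Gamma (a + (β * n + δ + 1))))
      = ∫ τ in (0:ℝ)..x, c n * ((x - τ) ^ (a - 1) * τ ^ (β * n + δ)) := by
    intro n
    have hb : 0 < β * n + δ + 1 := by positivity
    have := beta_scaled ha hb hx
    rw [intervalIntegral.integral_const_mul]
    rw [show β * n + δ + 1 - 1 = β * n + δ by ring] at this
    rw [this]; congr 3; ring
  simp_rw [e]
  have hk := kernel_intervalIntegrable (x := x) ha
  have hsum := (hc (x ^ β) (by positivity)).mul_left (x ^ δ)
  have eq : ∀ n : ℕ, ∀ τ : ℝ, 0 < τ → τ ^ (β * n + δ) = τ ^ δ * (τ ^ β) ^ n := by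
    intro n τ hτ
    rw [rpow_add hτ, rpow_mul hτ.le, rpow_natCast, mul_comm]
  refine intervalIntegral.hasSum_integral_of_dominated_convergence
    (fun n τ => (x - τ) ^ (a - 1) * (x ^ δ * (|c n| * (x ^ β) ^ n))) ?_ ?_ ?_ ?_ ?_
  · intro n
    apply Measurable.aestronglyMeasurable
    fun_prop
  · intro n
    refine ae_of_all _ fun τ hτ => ?_
    rw [uIoc_of_le hx.le] at hτ
    have h1 : 0 ≤ (x - τ) ^ (a - 1) := rpow_nonneg (sub_nonneg.2 hτ.2) _
    have h0 := hτ.1.le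
    have h2 : 0 ≤ τ ^ δ * (τ ^ β) ^ n := by positivity
    rw [eq n τ hτ.1, norm_mul, norm_mul, Real.norm_of_nonneg h1, Real.norm_of_nonneg h2,
      Real.norm_eq_abs]
    calc |c n| * ((x - τ) ^ (a - 1) * (τ ^ δ * (τ ^ β) ^ n))
        = (x - τ) ^ (a - 1) * (τ ^ δ * (|c n| * (τ ^ β) ^ n)) := by ring
      _ ≤ _ := by gcongr <;> exact hτ.2
  · exact ae_of_all _ fun τ _ => hsum.mul_left _
  · simp_rw [tsum_mul_left]
    exact hk.mul_const _
  · refine ae_of_all _ fun τ hτ => ?_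
    rw [uIoc_of_le hx.le] at hτ
    have := ((hc.summable (τ ^ β)).hasSum.mul_left (τ ^ δ)).mul_left ((x - τ) ^ (a - 1))
    refine (hs_congr fun n => ?_).1 this
    rw [eq n τ hτ.1]; ring


noncomputable def cC (α : ℝ) (n : ℕ) : ℝ := bCoef α n * (-1 / (1 + α)) ^ n

lemma bCoef_pos {α : ℝ} (hα : 0 < α) (n : ℕ) : 0 < bCoef α n := by
  unfold bCoef
  refine Finset.prod_pos fun i _ => div_pos (Real.Gamma_pos_of_pos (by positivity))
    (Real.Gamma_pos_of_pos (by positivity))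

lemma bCoef_succ (α : ℝ) (n : ℕ) : bCoef α (n + 1) =
    bCoef α n * (Real.Gamma (α * n + n + 2) / Real.Gamma (α * (n + 1) + n + 2)) := by
  unfold bCoef
  rw [Finset.prod_range_succ]

lemma cC_rec {α : ℝ} (hα : 0 < α) (n : ℕ) :
    cC α (n + 1) * Real.Gamma (α * (n + 1) + n + 2)
      = -(1 / (1 + α)) * cC α n * Real.Gamma (α * n + n + 2) := by
  have h : Real.Gamma (α * (n + 1) + n + 2) ≠ 0 := (Real.Gamma_pos_of_pos (by positivity)).ne'
  unfold cC
  rw [bCoef_succ, pow_succ]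
  field_simp

lemma Gamma_ratio_le {α x : ℝ} (hα : 0 < α) (hα1 : α < 1) (hx : 0 < x) :
    Real.Gamma x / Real.Gamma (x + α) ≤ (x + α) ^ (1 - α) / x := by
  have h := Real.Gamma_mul_add_mul_le_rpow_Gamma_mul_rpow_Gamma (s := x + α) (t := x + α + 1)
    (a := α) (b := 1 - α) (by positivity) (by positivity) hα (by linarith) (by ring)
  have hG := Real.Gamma_pos_of_pos (by positivity : 0 < x + α)
  rw [show α * (x + α) + (1 - α) * (x + α + 1) = x + 1 by ring, Real.Gamma_add_one hx.ne',
    Real.Gamma_add_one (by positivity), mul_rpow (by positivity) hG.le] at h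
  have e : Real.Gamma (x + α) ^ α * ((x + α) ^ (1 - α) * Real.Gamma (x + α) ^ (1 - α))
      = (x + α) ^ (1 - α) * Real.Gamma (x + α) := by
    have : Real.Gamma (x + α) ^ α * Real.Gamma (x + α) ^ (1 - α) = Real.Gamma (x + α) := by
      rw [← rpow_add hG]; simp
    calc _ = (x + α) ^ (1 - α) * (Real.Gamma (x + α) ^ α * Real.Gamma (x + α) ^ (1 - α)) := by ring
      _ = _ := by rw [this]
  rw [e] at h
  rw [div_le_div_iff₀ hG hx]
  linarith

lemma Gamma_ratio_tendsto {α : ℝ} (hα : 0 < α) (hα1 : α < 1) :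
    Tendsto (fun x => Real.Gamma x / Real.Gamma (x + α)) atTop (𝓝 0) := by
  have h1 : Tendsto (fun x : ℝ => 2 * x ^ (-α)) atTop (𝓝 0) := by
    simpa using (tendsto_rpow_neg_atTop hα).const_mul 2
  refine squeeze_zero' ?_ ?_ h1
  · filter_upwards [eventually_gt_atTop 0] with x hx
    exact (div_pos (Real.Gamma_pos_of_pos hx) (Real.Gamma_pos_of_pos (by positivity))).le
  · filter_upwards [eventually_gt_atTop 1] with x hx
    have hx0 : 0 < x := by linarith
    refine (Gamma_ratio_le hα hα1 hx0).trans ?_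
    rw [div_le_iff₀ hx0]
    calc (x + α) ^ (1 - α) ≤ (2 * x) ^ (1 - α) := by
          apply rpow_le_rpow (by positivity) (by linarith) (by linarith)
      _ = 2 ^ (1 - α) * x ^ (1 - α) := mul_rpow (by norm_num) hx0.le
      _ ≤ 2 ^ (1:ℝ) * x ^ (1 - α) := by
          gcongr
          · norm_num
          · linarith
      _ = 2 * x ^ (-α) * x := by
          rw [rpow_one, mul_assoc, show 1 - α = -α + 1 by ring, rpow_add hx0, rpow_one]

lemma cC_ent {α : ℝ} (hα : 0 < α) (hα1 : α < 1) : EntCoef (cC α) := by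
  intro r hr
  rcases hr.eq_or_lt with rfl | hr
  · refine summable_of_ne_finset_zero (s := {0}) ?_
    intro b hb
    simp at hb
    simp [hb]
  have habs : ∀ n, |cC α n| = bCoef α n * (1 / (1 + α)) ^ n := by
    intro n
    unfold cC
    rw [abs_mul, abs_of_pos (bCoef_pos hα n), abs_pow, abs_div, abs_of_pos (by positivity : 0 < 1 + α)]
    simp
  refine summable_of_ratio_test_tendsto_lt_one (l := 0) one_pos ?_ ?_
  · refine Eventually.of_forall fun n => ?_
    rw [habs]
    have := bCoef_pos hα n
    positivity
  · have h2 : Tendsto (fun n : ℕ => α * (n:ℝ) + n + 2) atTop atTop := by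
      refine tendsto_atTop_mono (fun n => ?_) tendsto_natCast_atTop_atTop
      have : 0 ≤ α * (n:ℝ) := by positivity
      linarith
    have h3 := ((Gamma_ratio_tendsto hα hα1).comp h2).mul_const (r / (1 + α))
    rw [zero_mul] at h3
    refine h3.congr fun n => ?_
    have hb := bCoef_pos hα n
    have hb' := bCoef_pos hα (n + 1)
    rw [Real.norm_of_nonneg (by positivity), Real.norm_of_nonneg (by positivity), habs, habs,
      bCoef_succ, Function.comp, show α * (n:ℝ) + n + 2 + α = α * (n + 1) + n + 2 by ring, pow_succ, pow_succ]
    field_simp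

/-- shifted coefficients -/
noncomputable def dC (α : ℝ) (n : ℕ) : ℝ := ((n : ℝ) + 1) * cC α (n + 1)

noncomputable def eC (α : ℝ) (n : ℕ) : ℝ := ((n : ℝ) + 1) * dC α (n + 1)

lemma dC_ent {α : ℝ} (hα : 0 < α) (hα1 : α < 1) : EntCoef (dC α) := (cC_ent hα hα1).shift

lemma Phi_eq (α x : ℝ) : Phi α x = PSer (cC α) (x ^ (1 + α)) := by
  unfold Phi PSer cC
  refine tsum_congr fun n => ?_
  rw [mul_assoc, ← mul_pow]
  congr 2; ring

noncomputable def Psi (α x : ℝ) : ℝ := -((1 + α) * (x ^ α * PSer (dC α) (x ^ (1 + α))))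

lemma Phi_zero {α : ℝ} (hα : 0 < α) : Phi α 0 = 1 := by
  rw [Phi_eq, zero_rpow (by positivity)]
  unfold PSer
  rw [tsum_eq_single 0]
  · simp [cC, bCoef]
  · intro n hn; simp [hn]

lemma Phi_hasDerivAt {α : ℝ} (hα : 0 < α) (hα1 : α < 1) (x : ℝ) :
    HasDerivAt (Phi α) (-Psi α x) x := by
  have h1 : HasDerivAt (fun x : ℝ => x ^ (1 + α)) ((1 + α) * x ^ α) x := by
    have := Real.hasDerivAt_rpow_const (x := x) (p := 1 + α) (Or.inr (by linarith))
    simpa using this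
  have h2 := (PSer.hasDerivAt (cC_ent hα hα1) (x ^ (1 + α))).comp x h1
  have e : Phi α = PSer (cC α) ∘ (fun x : ℝ => x ^ (1 + α)) := by
    funext x; exact Phi_eq α x
  rw [e]
  refine h2.congr_deriv ?_
  unfold Psi dC
  ring

lemma Psi_differentiableAt {α : ℝ} (hα : 0 < α) (hα1 : α < 1) {x : ℝ} (hx : 0 < x) :
    DifferentiableAt ℝ (Psi α) x := by
  have h1 : DifferentiableAt ℝ (fun x : ℝ => x ^ (1 + α)) x :=
    (Real.hasDerivAt_rpow_const (Or.inl hx.ne')).differentiableAt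
  have h2 : DifferentiableAt ℝ (fun x : ℝ => x ^ α) x :=
    (Real.hasDerivAt_rpow_const (Or.inl hx.ne')).differentiableAt
  have h3 := (PSer.hasDerivAt (dC_ent hα hα1) (x ^ (1 + α))).differentiableAt
  exact ((h2.mul (h3.comp x h1)).const_mul (1 + α)).neg

lemma Phi_continuous {α : ℝ} (hα : 0 < α) (hα1 : α < 1) : Continuous (Phi α) :=
  continuous_iff_continuousAt.2 fun x => (Phi_hasDerivAt hα hα1 x).continuousAt

lemma Psi_continuous {α : ℝ} (hα : 0 < α) (hα1 : α < 1) : Continuous (Psi α) := by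
  have h := PSer.continuous (dC_ent hα hα1)
  have h1 : Continuous (fun x : ℝ => x ^ (1 + α)) := continuous_id.rpow_const (fun _ => Or.inr (by linarith))
  have h2 : Continuous (fun x : ℝ => x ^ α) := continuous_id.rpow_const (fun _ => Or.inr (by linarith))
  unfold Psi
  exact (continuous_const.mul (h2.mul (h.comp h1))).neg

lemma Psi_frac {α : ℝ} (hα : 0 < α) (hα1 : α < 1) {x : ℝ} (hx : 0 < x) :
    ∫ τ in (0:ℝ)..x, (x - τ) ^ (-α) * Psi α τ = Real.Gamma (1 - α) / (1 + α) * (x * Phi α x) := by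
  have h := (hasSum_frac (dC_ent hα hα1) (a := 1 - α) (β := 1 + α) (δ := α) (x := x)
    (by linarith) (by linarith) hα.le hx).mul_left (-(1 + α))
  have e1 : -(1 + α) * ∫ τ in (0:ℝ)..x, (x - τ) ^ (1 - α - 1) * (τ ^ α * PSer (dC α) (τ ^ (1 + α)))
      = ∫ τ in (0:ℝ)..x, (x - τ) ^ (-α) * Psi α τ := by
    rw [← intervalIntegral.integral_const_mul]
    congr 1; funext τ
    unfold Psi
    rw [show 1 - α - 1 = -α by ring]; ring
  rw [e1] at h
  refine h.unique ?_
  have h2 := ((cC_ent hα hα1).summable (x ^ (1 + α))).hasSum.mul_left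
    (Real.Gamma (1 - α) / (1 + α) * x)
  rw [← mul_assoc, Phi_eq]
  refine (hs_congr fun n => ?_).1 h2
  have hG : Real.Gamma (α * n + n + 2) ≠ 0 := (Real.Gamma_pos_of_pos (by positivity)).ne'
  have hrec := cC_rec hα n
  rw [show α * ((n:ℝ) + 1) + n + 2 = ((1 + α) * n + α + 1) + 1 by ring,
    Real.Gamma_add_one (by positivity)] at hrec
  rw [show 1 - α + ((1 + α) * (n:ℝ) + α + 1) = α * n + n + 2 by ring,
    show 1 - α + ((1 + α) * (n:ℝ) + α) = 1 + (1 + α) * n by ring, rpow_add hx 1 ((1 + α) * n), rpow_one,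
    rpow_mul hx.le, rpow_natCast]
  unfold dC
  have h5 : cC α (n + 1) * (((1 + α) * n + α + 1) * Real.Gamma ((1 + α) * n + α + 1)) /
    Real.Gamma (α * n + n + 2) = -(1 / (1 + α)) * cC α n := by
    rw [hrec]; field_simp
  have h6 : cC α n = -(1 + α) * (cC α (n + 1) * (((1 + α) * n + α + 1) *
    Real.Gamma ((1 + α) * n + α + 1)) / Real.Gamma (α * n + n + 2)) := by
    rw [h5]; field_simp
  rw [h6]
  field_simp
  ring

lemma Phi_frac {α : ℝ} (hα : 0 < α) (hα1 : α < 1) {x : ℝ} (hx : 0 < x) :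
    ∫ τ in (0:ℝ)..x, (x - τ) ^ (α - 1) * (Phi α τ - τ * Psi α τ)
      = Real.Gamma α * (1 + α) * Psi α x := by
  set f : ℕ → ℝ := fun n => ((1 + α) * n + 1) * cC α n with hf
  have hfe : EntCoef f := by
    intro r hr
    have h1 := cC_ent hα hα1 r hr
    have h2 : Summable (fun n : ℕ => (n : ℝ) * (|cC α n| * r ^ n)) := by
      rw [← summable_nat_add_iff 1]
      refine ((dC_ent hα hα1 r hr).mul_left r).congr fun n => ?_
      unfold dC
      rw [abs_mul, abs_of_nonneg (by positivity : (0:ℝ) ≤ (n : ℝ) + 1)]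
      push_cast; ring
    refine ((h2.mul_left (1 + α)).add h1).congr fun n => ?_
    rw [hf]; simp only
    rw [abs_mul, abs_of_nonneg (by positivity : (0:ℝ) ≤ (1 + α) * (n : ℝ) + 1)]
    ring
  have e0 : ∀ τ : ℝ, 0 < τ → Phi α τ - τ * Psi α τ = PSer f (τ ^ (1 + α)) := by
    intro τ hτ
    rw [Phi_eq]
    unfold Psi
    have h1 := ((cC_ent hα hα1).summable (τ ^ (1 + α))).hasSum
    have h2 : HasSum (fun n : ℕ => (n : ℝ) * (cC α n * (τ ^ (1 + α)) ^ n))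
        (τ ^ (1 + α) * PSer (dC α) (τ ^ (1 + α))) := by
      rw [← hasSum_nat_add_iff' 1]
      simp only [Finset.sum_range_one, Nat.cast_zero, zero_mul, sub_zero]
      refine (hs_congr fun n => ?_).1
        (((dC_ent hα hα1).summable (τ ^ (1 + α))).hasSum.mul_left (τ ^ (1 + α)))
      unfold dC; push_cast; ring
    have h3 := (h2.mul_left (1 + α)).add h1
    have h4 : PSer f (τ ^ (1 + α)) = (1 + α) * (τ ^ (1 + α) * PSer (dC α) (τ ^ (1 + α)))
        + PSer (cC α) (τ ^ (1 + α)) := by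
      refine HasSum.tsum_eq ((hs_congr fun n => ?_).1 h3)
      rw [hf]; ring
    rw [h4, rpow_add hτ, rpow_one]
    ring
  have h := hasSum_frac hfe (a := α) (β := 1 + α) (δ := 0) (x := x)
    (by linarith) (by linarith) le_rfl hx
  have e1 : ∫ τ in (0:ℝ)..x, (x - τ) ^ (α - 1) * (τ ^ (0:ℝ) * PSer f (τ ^ (1 + α)))
      = ∫ τ in (0:ℝ)..x, (x - τ) ^ (α - 1) * (Phi α τ - τ * Psi α τ) := by
    refine intervalIntegral.integral_congr_ae (ae_of_all _ fun τ hτ => ?_)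
    rw [uIoc_of_le hx.le] at hτ
    rw [e0 τ hτ.1]; simp
  rw [e1] at h
  refine h.unique ?_
  have h2 := ((dC_ent hα hα1).summable (x ^ (1 + α))).hasSum.mul_left
    (-(Real.Gamma α * (1 + α) * (1 + α) * x ^ α))
  have e2 : Real.Gamma α * (1 + α) * Psi α x =
      -(Real.Gamma α * (1 + α) * (1 + α) * x ^ α) * PSer (dC α) (x ^ (1 + α)) := by
    unfold Psi; ring
  rw [e2]
  refine (hs_congr fun n => ?_).1 h2
  have hrec := cC_rec hα n
  rw [show α * ((n:ℝ) + 1) + n + 2 = (α + ((1 + α) * n + 0 + 1)) + 1 by ring,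
    Real.Gamma_add_one (by positivity), show α * (n:ℝ) + n + 2 = ((1 + α) * n + 0 + 1) + 1 by ring,
    Real.Gamma_add_one (by positivity)] at hrec
  have hG : Real.Gamma (α + ((1 + α) * n + 0 + 1)) ≠ 0 := (Real.Gamma_pos_of_pos (by positivity)).ne'
  rw [add_zero, rpow_add hx α ((1 + α) * n), rpow_mul hx.le, rpow_natCast]
  simp only [add_zero] at hrec hG ⊢
  have h6 : cC α n * ((1 + α) * n + 1) * Real.Gamma ((1 + α) * n + 1)
      = -(1 + α) * (cC α (n + 1) * ((α + ((1 + α) * n + 1)) * Real.Gamma (α + ((1 + α) * n + 1)))) := by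
    rw [hrec]; field_simp
  have h7 : f n * (x ^ α * (x ^ (1 + α)) ^ n * (Real.Gamma α * Real.Gamma ((1 + α) * n + 1) /
      Real.Gamma (α + ((1 + α) * n + 1)))) = (cC α n * ((1 + α) * n + 1) *
      Real.Gamma ((1 + α) * n + 1)) * (x ^ α * (x ^ (1 + α)) ^ n * Real.Gamma α /
      Real.Gamma (α + ((1 + α) * n + 1))) := by
    rw [hf]; ring
  rw [h7, h6]
  unfold dC
  field_simp
  ring


lemma Psi_zero {α : ℝ} (hα : 0 < α) : Psi α 0 = 0 := by
  unfold Psi; rw [zero_rpow hα.ne']; simp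

lemma Psi_pos_near {α : ℝ} (hα : 0 < α) (hα1 : α < 1) :
    ∃ ε > 0, ∀ x, 0 < x → x < ε → 0 < Psi α x := by
  have h1 : Continuous (fun x : ℝ => x ^ (1 + α)) :=
    continuous_id.rpow_const (fun _ => Or.inr (by linarith))
  have h2 : Continuous (fun x : ℝ => PSer (dC α) (x ^ (1 + α))) :=
    (PSer.continuous (dC_ent hα hα1)).comp h1
  have h3 : PSer (dC α) ((0:ℝ) ^ (1 + α)) < 0 := by
    rw [zero_rpow (by positivity)]
    have : PSer (dC α) 0 = dC α 0 := by
      unfold PSer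
      rw [tsum_eq_single 0]
      · simp
      · intro n hn; simp [hn]
    rw [this]
    unfold dC cC
    have := bCoef_pos hα 1
    simp only [Nat.cast_zero, zero_add, one_mul, pow_one]
    apply mul_neg_of_pos_of_neg this
    apply div_neg_of_neg_of_pos <;> linarith
  have h4 := h2.continuousAt.eventually_lt (continuousAt_const (y := (0:ℝ))) h3
  obtain ⟨ε, hε, h5⟩ := Metric.eventually_nhds_iff.1 h4
  refine ⟨ε, hε, fun x hx hxε => ?_⟩
  have h6 := h5 (y := x) (by simpa [abs_of_pos hx] using hxε)
  unfold Psi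
  have : 0 < x ^ α := rpow_pos_of_pos hx _
  have h7 : x ^ α * PSer (dC α) (x ^ (1 + α)) < 0 := mul_neg_of_pos_of_neg this h6
  have h8 : (1 + α) * (x ^ α * PSer (dC α) (x ^ (1 + α))) < 0 :=
    mul_neg_of_pos_of_neg (by linarith) h7
  linarith

lemma kern_int {f : ℝ → ℝ} (hf : Continuous f) {a x : ℝ} (ha : 0 < a) :
    IntervalIntegrable (fun τ => (x - τ) ^ (a - 1) * f τ) volume 0 x :=
  (kernel_intervalIntegrable ha).mul_continuousOn hf.continuousOn

lemma Phi_pos_of {α : ℝ} (hα : 0 < α) (hα1 : α < 1) {x : ℝ} (hx : 0 < x)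
    (h : ∀ τ, 0 < τ → τ < x → 0 < Psi α τ) : 0 < Phi α x := by
  have h1 : 0 < ∫ τ in (0:ℝ)..x, (x - τ) ^ (-α) * Psi α τ := by
    refine intervalIntegral.intervalIntegral_pos_of_pos_on ?_ ?_ hx
    · have := kern_int (Psi_continuous hα hα1) (a := 1 - α) (x := x) (by linarith)
      simpa using this
    · intro τ hτ
      exact mul_pos (rpow_pos_of_pos (sub_pos.2 hτ.2) _) (h τ hτ.1 hτ.2)
  rw [Psi_frac hα hα1 hx] at h1
  have h2 : 0 < Real.Gamma (1 - α) / (1 + α) :=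
    div_pos (Real.Gamma_pos_of_pos (by linarith)) (by linarith)
  have h3 := (mul_pos_iff_of_pos_left h2).1 h1
  exact (mul_pos_iff_of_pos_left hx).1 h3

lemma Psi_pos {α : ℝ} (hα : 0 < α) (hα1 : α < 1) : ∀ x, 0 < x → 0 < Psi α x := by
  by_contra hcon
  push Not at hcon
  obtain ⟨x1, hx1, hx1'⟩ := hcon
  obtain ⟨ε0, hε0, hnear⟩ := Psi_pos_near hα hα1
  set S : Set ℝ := {x | ε0 ≤ x ∧ Psi α x ≤ 0} with hS
  have hmem : ∀ x, 0 < x → Psi α x ≤ 0 → x ∈ S := by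
    intro x hx hx'
    refine ⟨?_, hx'⟩
    by_contra hlt
    exact absurd (hnear x hx (not_le.1 hlt)) (not_lt.2 hx')
  have hSne : S.Nonempty := ⟨x1, hmem x1 hx1 hx1'⟩
  have hSbdd : BddBelow S := ⟨ε0, fun x hx => hx.1⟩
  have hScl : IsClosed S :=
    (isClosed_le continuous_const continuous_id).inter
      (isClosed_le (Psi_continuous hα hα1) continuous_const)
  set x0 := sInf S with hx0d
  have hx0S : x0 ∈ S := hScl.csInf_mem hSne hSbdd
  have hx0 : 0 < x0 := hε0.trans_le hx0S.1
  have hpos : ∀ τ, 0 < τ → τ < x0 → 0 < Psi α τ := by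
    intro τ h1 h2
    by_contra h3
    exact absurd (csInf_le hSbdd (hmem τ h1 (not_lt.1 h3))) (not_le.2 h2)
  have hPhi : 0 < Phi α x0 := Phi_pos_of hα hα1 hx0 hpos
  have hz : Psi α x0 = 0 := by
    refine le_antisymm hx0S.2 ?_
    have ht : Tendsto (Psi α) (𝓝[<] x0) (𝓝 (Psi α x0)) :=
      (Psi_continuous hα hα1).continuousAt.tendsto.mono_left nhdsWithin_le_nhds
    refine ge_of_tendsto ht ?_
    filter_upwards [Ioo_mem_nhdsLT hx0] with τ hτ
    exact (hpos τ hτ.1 hτ.2).le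
  -- linear bound
  obtain ⟨L, hL, hLb⟩ : ∃ L > 0, ∀ᶠ τ in 𝓝 x0, |Psi α τ| ≤ L * |τ - x0| := by
    have hO := (Psi_differentiableAt hα hα1 hx0).isBigO_sub
    obtain ⟨L, hL, hb⟩ := hO.exists_pos
    refine ⟨L, hL, ?_⟩
    filter_upwards [hb.bound] with τ hτ
    simpa [hz] using hτ
  obtain ⟨η, hη, hLb⟩ := Metric.eventually_nhds_iff.1 hLb
  set k := Real.Gamma (1 - α) / (1 + α) with hk
  have hkpos : 0 < k := div_pos (Real.Gamma_pos_of_pos (by linarith)) (by linarith)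
  have hH : HasDerivAt (fun ε : ℝ => k * ((x0 - ε) * Phi α (x0 - ε))) (-(k * Phi α x0)) 0 := by
    have h1 : HasDerivAt (fun ε : ℝ => x0 - ε) (-1) 0 := by
      simpa using (hasDerivAt_id (0:ℝ)).const_sub x0
    have h2 : HasDerivAt (Phi α) (-Psi α (x0 - 0)) (x0 - 0) := Phi_hasDerivAt hα hα1 _
    have h3 := ((h1.mul (h2.comp (0:ℝ) h1)).const_mul k)
    refine h3.congr_deriv ?_
    simp [hz]
  have hs := hH.tendsto_slope_zero_right
  have hT : Tendsto (fun ε : ℝ => -(L * ε ^ (1 - α))) (𝓝[>] 0) (𝓝 0) := by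
    have h1 : Continuous (fun ε : ℝ => -(L * ε ^ (1 - α))) :=
      (continuous_const.mul (continuous_id.rpow_const (fun _ => Or.inr (by linarith)))).neg
    have h2 := h1.tendsto 0
    rw [zero_rpow (by linarith : 1 - α ≠ 0)] at h2
    simpa using h2.mono_left nhdsWithin_le_nhds
  have hfin : (0:ℝ) ≤ -(k * Phi α x0) := by
    refine le_of_tendsto_of_tendsto hT hs ?_
    filter_upwards [Ioo_mem_nhdsGT (lt_min hη hx0)] with ε hε
    have hε0 : 0 < ε := hε.1
    have hεη : ε < η := hε.2.trans_le (min_le_left _ _)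
    have hεx : ε < x0 := hε.2.trans_le (min_le_right _ _)
    have hxε : 0 < x0 - ε := by linarith
    simp only [zero_add, sub_zero, smul_eq_mul]
    rw [hk, ← Psi_frac hα hα1 hx0, ← Psi_frac hα hα1 hxε]
    have hi1 : IntervalIntegrable (fun τ => (x0 - τ) ^ (-α) * Psi α τ) volume 0 x0 := by
      simpa using kern_int (Psi_continuous hα hα1) (a := 1 - α) (x := x0) (by linarith)
    have hi2 : IntervalIntegrable (fun τ => (x0 - ε - τ) ^ (-α) * Psi α τ) volume 0 (x0 - ε) := by
      simpa using kern_int (Psi_continuous hα hα1) (a := 1 - α) (x := x0 - ε) (by linarith)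
    have hia : IntervalIntegrable (fun τ => (x0 - τ) ^ (-α) * Psi α τ) volume 0 (x0 - ε) :=
      hi1.mono_set (by rw [uIcc_of_le hxε.le, uIcc_of_le hx0.le]; exact Icc_subset_Icc le_rfl (by linarith))
    have hib : IntervalIntegrable (fun τ => (x0 - τ) ^ (-α) * Psi α τ) volume (x0 - ε) x0 :=
      hi1.mono_set (by rw [uIcc_of_le (by linarith), uIcc_of_le hx0.le]; exact Icc_subset_Icc hxε.le le_rfl)
    rw [← intervalIntegral.integral_add_adjacent_intervals hia hib]
    have hA : ∫ τ in (0:ℝ)..(x0 - ε), (x0 - τ) ^ (-α) * Psi α τ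
        ≤ ∫ τ in (0:ℝ)..(x0 - ε), (x0 - ε - τ) ^ (-α) * Psi α τ := by
      refine intervalIntegral.integral_mono_on_of_le_Ioo hxε.le hia hi2 fun τ hτ => ?_
      refine mul_le_mul_of_nonneg_right ?_ (hpos τ hτ.1 (by linarith [hτ.2])).le
      exact rpow_le_rpow_of_nonpos (by linarith [hτ.2]) (by linarith) (by linarith)
    have hB : ‖∫ τ in (x0 - ε)..x0, (x0 - τ) ^ (-α) * Psi α τ‖ ≤ L * ε ^ (1 - α) * |x0 - (x0 - ε)| := by
      refine intervalIntegral.norm_integral_le_of_norm_le_const fun τ hτ => ?_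
      rw [uIoc_of_le (by linarith)] at hτ
      rcases hτ.2.eq_or_lt with rfl | hlt
      · rw [hz]; simp; positivity
      have hd : 0 < x0 - τ := sub_pos.2 hlt
      have h1 := hLb (y := τ) (by rw [Real.dist_eq, abs_sub_comm, abs_of_pos hd]; linarith [hτ.1])
      rw [abs_sub_comm, abs_of_pos hd] at h1
      rw [norm_mul, Real.norm_of_nonneg (rpow_nonneg hd.le _), Real.norm_eq_abs]
      calc (x0 - τ) ^ (-α) * |Psi α τ| ≤ (x0 - τ) ^ (-α) * (L * (x0 - τ)) := by gcongr
        _ = L * (x0 - τ) ^ (1 - α) := by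
          rw [show 1 - α = -α + 1 by ring, rpow_add hd, rpow_one]; ring
        _ ≤ L * ε ^ (1 - α) := by
          gcongr
          linarith [hτ.1]
    rw [show x0 - (x0 - ε) = ε by ring, abs_of_pos hε0, Real.norm_eq_abs] at hB
    have hB' := (abs_le.1 hB).2
    rw [inv_mul_eq_div, le_div_iff₀ hε0]
    linarith
  have := mul_pos hkpos hPhi
  linarith

lemma Phi_pos {α : ℝ} (hα : 0 < α) (hα1 : α < 1) {x : ℝ} (hx : 0 ≤ x) : 0 < Phi α x := by
  rcases hx.eq_or_lt with rfl | hx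
  · rw [Phi_zero hα]; exact one_pos
  · exact Phi_pos_of hα hα1 hx fun τ h _ => Psi_pos hα hα1 τ h

lemma Phi_antitone {α : ℝ} (hα : 0 < α) (hα1 : α < 1) : AntitoneOn (Phi α) (Ici 0) := by
  refine antitoneOn_of_deriv_nonpos (convex_Ici 0) (Phi_continuous hα hα1).continuousOn
    (fun x _ => (Phi_hasDerivAt hα hα1 x).differentiableAt.differentiableWithinAt) fun x hx => ?_
  rw [interior_Ici] at hx
  rw [(Phi_hasDerivAt hα hα1 x).deriv]
  linarith [Psi_pos hα hα1 x hx]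

lemma Phi_le_one {α : ℝ} (hα : 0 < α) (hα1 : α < 1) {x : ℝ} (hx : 0 ≤ x) : Phi α x ≤ 1 := by
  rw [← Phi_zero hα]
  exact Phi_antitone hα hα1 (mem_Ici.2 le_rfl) (mem_Ici.2 hx) hx

lemma Psi_bound {α : ℝ} (hα : 0 < α) (hα1 : α < 1) (hI : IntegrableOn (Phi α) (Ioi 0)) :
    ∃ M > 0, ∀ x, 0 < x → Psi α x ≤ M := by
  set I := ∫ x in Ioi (0:ℝ), Phi α x with hId
  have hI0 : 0 ≤ I := setIntegral_nonneg measurableSet_Ioi fun x hx => (Phi_pos hα hα1 (le_of_lt hx)).le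
  have hG : 0 < Real.Gamma α * (1 + α) := mul_pos (Real.Gamma_pos_of_pos hα) (by linarith)
  refine ⟨(I + 1 / α) / (Real.Gamma α * (1 + α)), by positivity, fun x hx => ?_⟩
  rw [le_div_iff₀ hG, mul_comm, ← Phi_frac hα hα1 hx]
  have hPc := Phi_continuous hα hα1
  have hf1 : IntervalIntegrable (fun τ => (x - τ) ^ (α - 1) * (Phi α τ - τ * Psi α τ)) volume 0 x :=
    kern_int (hPc.sub (continuous_id.mul (Psi_continuous hα hα1))) hα
  have hf2 : IntervalIntegrable (fun τ => (x - τ) ^ (α - 1) * Phi α τ) volume 0 x :=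
    kern_int hPc hα
  have hk := kernel_intervalIntegrable (x := x) hα
  set m := max 0 (x - 1) with hm
  have hm0 : 0 ≤ m := le_max_left _ _
  have hmx : m ≤ x := max_le hx.le (by linarith)
  have hm1 : x - 1 ≤ m := le_max_right _ _
  have s1 : uIcc 0 m ⊆ uIcc 0 x := by
    rw [uIcc_of_le hm0, uIcc_of_le hx.le]; exact Icc_subset_Icc le_rfl hmx
  have s2 : uIcc m x ⊆ uIcc 0 x := by
    rw [uIcc_of_le hmx, uIcc_of_le hx.le]; exact Icc_subset_Icc hm0 le_rfl
  calc ∫ τ in (0:ℝ)..x, (x - τ) ^ (α - 1) * (Phi α τ - τ * Psi α τ)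
      ≤ ∫ τ in (0:ℝ)..x, (x - τ) ^ (α - 1) * Phi α τ := by
        refine intervalIntegral.integral_mono_on_of_le_Ioo hx.le hf1 hf2 fun τ hτ => ?_
        refine mul_le_mul_of_nonneg_left ?_ (rpow_nonneg (by linarith [hτ.2]) _)
        have := mul_pos hτ.1 (Psi_pos hα hα1 τ hτ.1)
        linarith
    _ = (∫ τ in (0:ℝ)..m, (x - τ) ^ (α - 1) * Phi α τ) + ∫ τ in m..x, (x - τ) ^ (α - 1) * Phi α τ :=
        (intervalIntegral.integral_add_adjacent_intervals (hf2.mono_set s1) (hf2.mono_set s2)).symm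
    _ ≤ I + 1 / α := by
        refine add_le_add ?_ ?_
        · calc ∫ τ in (0:ℝ)..m, (x - τ) ^ (α - 1) * Phi α τ ≤ ∫ τ in (0:ℝ)..m, Phi α τ := by
                refine intervalIntegral.integral_mono_on_of_le_Ioo hm0 (hf2.mono_set s1)
                  (hPc.intervalIntegrable _ _) fun τ hτ => ?_
                refine mul_le_of_le_one_left (Phi_pos hα hα1 hτ.1.le).le ?_
                have : m = x - 1 := by
                  rcases max_choice 0 (x - 1) with h | h
                  · exfalso; have h1 := hτ.1; have h2 := hτ.2; rw [hm, h] at h2; linarith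
                  · rw [hm, h]
                exact rpow_le_one_of_one_le_of_nonpos (by linarith [hτ.2]) (by linarith)
            _ ≤ I := by
                rw [intervalIntegral.integral_of_le hm0]
                refine setIntegral_mono_set hI ?_ (Ioc_subset_Ioi_self.eventuallyLE)
                refine (ae_restrict_iff' measurableSet_Ioi).2 (ae_of_all _ fun τ hτ => ?_)
                exact (Phi_pos hα hα1 (le_of_lt hτ)).le
        · calc ∫ τ in m..x, (x - τ) ^ (α - 1) * Phi α τ ≤ ∫ τ in m..x, (x - τ) ^ (α - 1) := by
                refine intervalIntegral.integral_mono_on_of_le_Ioo hmx (hf2.mono_set s2)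
                  (hk.mono_set s2) fun τ hτ => ?_
                refine mul_le_of_le_one_right (rpow_nonneg (by linarith [hτ.2]) _) ?_
                exact Phi_le_one hα hα1 (by linarith [hτ.1])
            _ = (x - m) ^ α / α := by
                rw [intervalIntegral.integral_comp_sub_left (fun u => u ^ (α - 1)) x,
                  integral_rpow (Or.inl (by linarith))]
                simp [zero_rpow hα.ne']
            _ ≤ 1 / α := by
                gcongr
                exact rpow_le_one (by linarith) (by linarith) hα.le

lemma Phi_lip {α : ℝ} (hα : 0 < α) (hα1 : α < 1) {M : ℝ} (hM : 0 < M)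
    (h : ∀ x, 0 < x → Psi α x ≤ M) {u v : ℝ} (hu : 0 ≤ u) (huv : u ≤ v) :
    Phi α u - Phi α v ≤ M * (v - u) := by
  have h1 := Convex.norm_image_sub_le_of_norm_hasDerivWithin_le (f := Phi α) (f' := fun x => -Psi α x)
    (s := Ici 0) (C := M) (fun x _ => (Phi_hasDerivAt hα hα1 x).hasDerivWithinAt) (fun x hx => ?_)
    (convex_Ici 0) (mem_Ici.2 hu) (mem_Ici.2 (hu.trans huv))
  · rw [Real.norm_eq_abs, Real.norm_eq_abs, abs_of_nonneg (sub_nonneg.2 huv)] at h1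
    linarith [(abs_le.1 h1).1]
  · rcases (mem_Ici.1 hx).eq_or_lt with rfl | hx
    · simp [Psi_zero hα, hM.le]
    · rw [norm_neg, Real.norm_of_nonneg (Psi_pos hα hα1 x hx).le]
      exact h x hx


lemma shift_Ioi {E : ℝ → ℝ} (d : ℝ) (hE : IntegrableOn E (Ioi d)) :
    IntegrableOn (fun x => E (x + d)) (Ioi 0) ∧
      ∫ x in Ioi (0:ℝ), E (x + d) = ∫ x in Ioi d, E x := by
  have hp : (fun x => x + d) ⁻¹' (Ioi d) = Ioi 0 := by ext x; simp
  have hm := measurePreserving_add_right (volume : Measure ℝ) d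
  constructor
  · have := (hm.integrableOn_comp_preimage (measurableEmbedding_addRight d) (f := E) (s := Ioi d)).2 hE
    rwa [hp] at this
  · have := hm.setIntegral_preimage_emb (measurableEmbedding_addRight d) E (Ioi d)
    rwa [hp] at this

lemma interp_bound {f : ℝ → ℝ} {W : ℝ → ENNReal} {μ : Measure ℝ} {θ a b : ℝ}
    (hθ : θ ∈ Ioo (0:ℝ) 1) (ha : 0 ≤ a) (hb : 0 ≤ b)
    (h1 : ∀ᵐ x ∂μ, ‖f x‖ₑ ≤ W x) (h2 : ∀ᵐ x ∂μ, W x ≤ ENNReal.ofReal a)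
    (h3 : ∫⁻ x, W x ∂μ ≤ ENNReal.ofReal b) :
    eLpNorm f (ENNReal.ofReal (1 / (1 - θ))) μ ≤ ENNReal.ofReal (a ^ θ * b ^ (1 - θ)) := by
  have hθ1 : 0 < 1 - θ := by linarith [hθ.2]
  set p := 1 / (1 - θ) with hp
  have hp0 : 0 < p := by positivity
  have hp1 : 1 ≤ p := by rw [hp, le_div_iff₀ hθ1]; linarith [hθ.1]
  rw [eLpNorm_eq_lintegral_rpow_enorm_toReal (by simpa using hp0) ENNReal.ofReal_ne_top,
    ENNReal.toReal_ofReal hp0.le]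
  have key : ∫⁻ x, ‖f x‖ₑ ^ p ∂μ ≤ ENNReal.ofReal a ^ (p - 1) * ENNReal.ofReal b := by
    calc ∫⁻ x, ‖f x‖ₑ ^ p ∂μ ≤ ∫⁻ x, ENNReal.ofReal a ^ (p - 1) * W x ∂μ := by
          refine lintegral_mono_ae ?_
          filter_upwards [h1, h2] with x hx1 hx2
          calc ‖f x‖ₑ ^ p ≤ W x ^ p := ENNReal.rpow_le_rpow hx1 hp0.le
            _ = W x ^ (p - 1) * W x := by
              conv_rhs => rw [← ENNReal.rpow_one (W x), ← ENNReal.rpow_mul, one_mul]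
              rw [← ENNReal.rpow_add_of_nonneg _ _ (by linarith) zero_le_one]
              simp
            _ ≤ _ := by
              gcongr
      _ = ENNReal.ofReal a ^ (p - 1) * ∫⁻ x, W x ∂μ :=
          lintegral_const_mul' _ _ (ENNReal.rpow_ne_top_of_nonneg (by linarith) ENNReal.ofReal_ne_top)
      _ ≤ _ := by gcongr
  calc (∫⁻ x, ‖f x‖ₑ ^ p ∂μ) ^ (1 / p)
      ≤ (ENNReal.ofReal a ^ (p - 1) * ENNReal.ofReal b) ^ (1 / p) :=
        ENNReal.rpow_le_rpow key (by positivity)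
    _ = ENNReal.ofReal (a ^ θ * b ^ (1 - θ)) := by
        rw [ENNReal.mul_rpow_of_nonneg _ _ (by positivity), ← ENNReal.rpow_mul,
          show (p - 1) * (1 / p) = θ by rw [hp]; field_simp; ring,
          show 1 / p = 1 - θ by rw [hp]; field_simp,
          ENNReal.ofReal_rpow_of_nonneg ha hθ.1.le, ENNReal.ofReal_rpow_of_nonneg hb hθ1.le,
          ENNReal.ofReal_mul (by positivity)]

lemma main_bound {α θ : ℝ} (hα : 0 < α) (hα1 : α < 1) (hθ : θ ∈ Ioo (0:ℝ) 1)
    (hI : IntegrableOn (Phi α) (Ioi 0)) {A M s : ℝ} (hA : 0 ≤ A) (hM1 : 1 ≤ M) (hs : 0 < s)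
    (hM : ∀ x, 0 < x → Psi α x ≤ M) {E : ℝ → ℝ} (hE : ∀ x, E x = A * s * Phi α (|x| * s))
    {g : ℝ → ℝ} (hg : IntegrableOn g (Ioi 0)) (hyg : IntegrableOn (fun y => y * g y) (Ioi 0)) :
    eLpNorm (fun x => ∫ y in Ioi (0:ℝ), (E (x - y) - E (x + y)) * g y)
      (ENNReal.ofReal (1 / (1 - θ))) (volume.restrict (Ioi 0)) ≤
    ENNReal.ofReal (2 * A * M * s ^ (1 + θ) * ∫ y in Ioi (0:ℝ), |y * g y|) := by
  set G := ∫ y in Ioi (0:ℝ), |y * g y| with hG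
  have hG0 : 0 ≤ G := integral_nonneg fun y => abs_nonneg _
  have hM0 : 0 < M := by linarith
  set B := 2 * A * M * G with hB
  have hB0 : 0 ≤ B := by positivity
  have hEc : Continuous E := by
    have : E = fun x => A * s * Phi α (|x| * s) := funext hE
    rw [this]
    exact continuous_const.mul ((Phi_continuous hα hα1).comp (continuous_abs.mul continuous_const))
  have hElip : ∀ x y : ℝ, 0 < x → 0 < y → E (x - y) - E (x + y) ≤ 2 * A * M * s ^ 2 * y := by
    intro x y hx hy
    have h1 : |x - y| ≤ x + y := abs_le.2 ⟨by linarith, by linarith⟩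
    have h2 : x - y ≤ |x - y| := le_abs_self _
    have h3 := Phi_lip hα hα1 hM0 hM (u := |x - y| * s) (v := (x + y) * s) (by positivity) (by gcongr)
    rw [hE, hE, abs_of_pos (by positivity : 0 < x + y), ← mul_sub]
    calc A * s * (Phi α (|x - y| * s) - Phi α ((x + y) * s))
        ≤ A * s * (M * ((x + y) * s - |x - y| * s)) := by gcongr
      _ = A * s * M * s * (x + y - |x - y|) := by ring
      _ ≤ A * s * M * s * (2 * y) := by
          gcongr
          linarith
      _ = _ := by ring
  have hEnn : ∀ x y : ℝ, 0 < x → 0 < y → 0 ≤ E (x - y) - E (x + y) := by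
    intro x y hx hy
    have h1 : |x - y| ≤ x + y := abs_le.2 ⟨by linarith, by linarith⟩
    have h3 := Phi_antitone hα hα1 (a := |x - y| * s) (b := (x + y) * s)
      (mem_Ici.2 (by positivity)) (mem_Ici.2 (by positivity)) (by gcongr)
    rw [hE, hE, abs_of_pos (by positivity : 0 < x + y), ← mul_sub]
    exact mul_nonneg (by positivity) (sub_nonneg.2 h3)
  have hEI0 : IntegrableOn E (Ioi 0) := by
    have h1 : IntegrableOn (fun x => Phi α (x * s)) (Ioi 0) := by
      rw [integrableOn_Ioi_comp_mul_right_iff (Phi α) 0 hs]; simpa using hI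
    have h2 : IntegrableOn (fun x => A * s * Phi α (x * s)) (Ioi 0) := h1.const_mul (A * s)
    refine h2.congr_fun (fun x hx => ?_) measurableSet_Ioi
    simp only
    rw [hE, abs_of_pos (mem_Ioi.1 hx)]
  have hEI : ∀ d : ℝ, IntegrableOn E (Ioi d) := by
    intro d
    have h1 : IntegrableOn E (Icc d 0 ∪ Ioi 0) :=
      (hEc.continuousOn.integrableOn_compact isCompact_Icc).union hEI0
    refine h1.mono_set fun x hx => ?_
    rcases le_or_gt x 0 with h | h
    · exact Or.inl ⟨le_of_lt hx, h⟩
    · exact Or.inr h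
  have hL1 : ∀ y : ℝ, 0 < y → ∫⁻ x in Ioi (0:ℝ), ENNReal.ofReal (E (x - y) - E (x + y))
      ≤ ENNReal.ofReal (2 * A * s * y) := by
    intro y hy
    obtain ⟨i1, e1⟩ := shift_Ioi (-y) (hEI (-y))
    obtain ⟨i2, e2⟩ := shift_Ioi y (hEI y)
    simp only [← sub_eq_add_neg] at i1 e1
    have i3 : IntegrableOn (fun x => E (x - y) - E (x + y)) (Ioi 0) := i1.sub i2
    rw [← ofReal_integral_eq_lintegral_ofReal i3]
    · refine ENNReal.ofReal_le_ofReal ?_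
      rw [integral_sub i1 i2, e1, e2, intervalIntegral.integral_Ioi_sub_Ioi (hEI (-y)) (by linarith)]
      calc ∫ x in (-y)..y, E x ≤ ∫ x in (-y)..y, A * s := by
            refine intervalIntegral.integral_mono_on (by linarith) (hEc.intervalIntegrable _ _)
              intervalIntegrable_const fun x _ => ?_
            rw [hE]
            exact mul_le_of_le_one_right (by positivity) (Phi_le_one hα hα1 (by positivity))
        _ = 2 * A * s * y := by simp; ring
    · refine (ae_restrict_iff' measurableSet_Ioi).2 (ae_of_all _ fun x hx => ?_)
      exact hEnn x y hx hy
  have hyG : ∫⁻ y in Ioi (0:ℝ), ENNReal.ofReal y * ‖g y‖ₑ = ENNReal.ofReal G := by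
    rw [hG, ofReal_integral_eq_lintegral_ofReal hyg.abs (ae_of_all _ fun y => abs_nonneg _)]
    refine setLIntegral_congr_fun measurableSet_Ioi fun y hy => ?_
    rw [abs_mul, ENNReal.ofReal_mul (abs_nonneg _), abs_of_pos (mem_Ioi.1 hy),
      ← Real.enorm_eq_ofReal_abs]
  set W : ℝ → ENNReal := fun x => ∫⁻ y in Ioi (0:ℝ), ENNReal.ofReal (E (x - y) - E (x + y)) * ‖g y‖ₑ
    with hW
  have b1 : ∀ᵐ x ∂(volume.restrict (Ioi (0:ℝ))),
      ‖∫ y in Ioi (0:ℝ), (E (x - y) - E (x + y)) * g y‖ₑ ≤ W x := by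
    refine (ae_restrict_iff' measurableSet_Ioi).2 (ae_of_all _ fun x hx => ?_)
    refine (enorm_integral_le_lintegral_enorm _).trans ?_
    refine setLIntegral_mono' measurableSet_Ioi fun y hy => ?_
    rw [enorm_mul, Real.enorm_of_nonneg (hEnn x y hx hy)]
  have b2 : ∀ᵐ x ∂(volume.restrict (Ioi (0:ℝ))), W x ≤ ENNReal.ofReal (B * s ^ 2) := by
    refine (ae_restrict_iff' measurableSet_Ioi).2 (ae_of_all _ fun x hx => ?_)
    calc W x ≤ ∫⁻ y in Ioi (0:ℝ), ENNReal.ofReal (2 * A * M * s ^ 2) * (ENNReal.ofReal y * ‖g y‖ₑ) := by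
          refine setLIntegral_mono' measurableSet_Ioi fun y hy => ?_
          rw [← mul_assoc, ← ENNReal.ofReal_mul (by positivity)]
          gcongr
          exact hElip x y hx hy
      _ = ENNReal.ofReal (2 * A * M * s ^ 2) * ENNReal.ofReal G := by
          rw [lintegral_const_mul' _ _ ENNReal.ofReal_ne_top, hyG]
      _ = ENNReal.ofReal (B * s ^ 2) := by
          rw [← ENNReal.ofReal_mul (by positivity)]; congr 1; rw [hB]; ring
  have b3 : ∫⁻ x in Ioi (0:ℝ), W x ≤ ENNReal.ofReal (B * s) := by
    rw [hW, lintegral_lintegral_swap]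
    · calc ∫⁻ y in Ioi (0:ℝ), ∫⁻ x in Ioi (0:ℝ), ENNReal.ofReal (E (x - y) - E (x + y)) * ‖g y‖ₑ
          ≤ ∫⁻ y in Ioi (0:ℝ), ENNReal.ofReal (2 * A * s) * (ENNReal.ofReal y * ‖g y‖ₑ) := by
            refine setLIntegral_mono' measurableSet_Ioi fun y hy => ?_
            rw [lintegral_mul_const' _ _ enorm_ne_top, ← mul_assoc,
              ← ENNReal.ofReal_mul (by positivity)]
            gcongr
            exact hL1 y hy
        _ = ENNReal.ofReal (2 * A * s * G) := by
            rw [lintegral_const_mul' _ _ ENNReal.ofReal_ne_top, hyG, ← ENNReal.ofReal_mul (by positivity)]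
        _ ≤ ENNReal.ofReal (B * s) := by
            refine ENNReal.ofReal_le_ofReal ?_
            have : 0 ≤ 2 * A * s * G := by positivity
            calc 2 * A * s * G = 2 * A * s * G * 1 := by ring
              _ ≤ 2 * A * s * G * M := by gcongr
              _ = B * s := by rw [hB]; ring
    · have hm : Measurable (fun z : ℝ × ℝ => ENNReal.ofReal (E (z.1 - z.2) - E (z.1 + z.2))) := by
        have := hEc.measurable
        fun_prop
      have hg' : AEMeasurable g (volume.restrict (Ioi 0)) := hg.aestronglyMeasurable.aemeasurable
      exact hm.aemeasurable.mul (hg'.comp_snd.enorm)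
  have hfin := interp_bound hθ (by positivity) (by positivity) b1 b2 b3
  refine hfin.trans (le_of_eq ?_)
  congr 1
  rw [mul_rpow hB0 (by positivity), mul_rpow hB0 hs.le]
  have h5 : B ^ θ * B ^ (1 - θ) = B := by
    rw [← rpow_add_of_nonneg hB0 hθ.1.le (by linarith [hθ.2])]; simp
  have h6 : (s ^ 2) ^ θ * s ^ (1 - θ) = s ^ (1 + θ) := by
    rw [← rpow_natCast, ← rpow_mul hs.le, ← rpow_add hs]; congr 1; push_cast; ring
  calc B ^ θ * (s ^ 2) ^ θ * (B ^ (1 - θ) * s ^ (1 - θ))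
      = (B ^ θ * B ^ (1 - θ)) * ((s ^ 2) ^ θ * s ^ (1 - θ)) := by ring
    _ = _ := by rw [h5, h6, hB]; ring


/-- Decay of the solution `w₁` of the Dirichlet problem in `L^{1/(1−θ)}(0,∞)`. -/
theorem stmt13 (α θ : ℝ) (hα : α ∈ Set.Ioo (0:ℝ) 1) (hθ : θ ∈ Set.Ioo (0:ℝ) 1) :
    ∃ C > (0:ℝ), ∀ g : ℝ → ℝ, IntegrableOn g (Set.Ioi 0) →
      IntegrableOn (fun y => y * g y) (Set.Ioi 0) → HasCompactSupport g →
      ∀ t > (1:ℝ),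
        eLpNorm (fun x => ∫ y in Set.Ioi (0:ℝ),
            (fundSol α t (x - y) - fundSol α t (x + y)) * g y)
          (ENNReal.ofReal (1/(1-θ))) (volume.restrict (Set.Ioi 0)) ≤
        ENNReal.ofReal (C * t ^ (-(1+θ)/(1+α)) * ∫ y in Set.Ioi (0:ℝ), |y * g y|) := by
  obtain ⟨hα0, hα1⟩ := hα
  by_cases hI : IntegrableOn (Phi α) (Ioi 0)
  · obtain ⟨M, hM0, hM⟩ := Psi_bound hα0 hα1 hI
    have hA : 0 ≤ a0 α := by
      unfold a0
      have : 0 ≤ ∫ x in Ioi (0:ℝ), Phi α x :=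
        setIntegral_nonneg measurableSet_Ioi fun x hx => (Phi_pos hα0 hα1 (le_of_lt hx)).le
      positivity
    refine ⟨2 * a0 α * max M 1 + 1, by positivity, fun g hg hyg _ t ht => ?_⟩
    have ht0 : 0 < t := by linarith
    have h := main_bound hα0 hα1 hθ hI hA (le_max_right M 1) (s := t ^ (-1 / (1 + α)))
      (rpow_pos_of_pos ht0 _) (fun x hx => (hM x hx).trans (le_max_left _ _))
      (E := fundSol α t) (fun x => rfl) hg hyg
    refine h.trans (ENNReal.ofReal_le_ofReal ?_)
    have hG0 : 0 ≤ ∫ y in Ioi (0:ℝ), |y * g y| := integral_nonneg fun y => abs_nonneg _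
    rw [← rpow_mul ht0.le, show -1 / (1 + α) * (1 + θ) = -(1 + θ) / (1 + α) by ring]
    gcongr
    linarith
  · have hz : a0 α = 0 := by
      unfold a0
      rw [integral_undef hI]; simp
    refine ⟨1, one_pos, fun g _ _ _ t _ => ?_⟩
    simp [fundSol, hz]
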